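/- (Dixmier–Malliavin theorem for C*-dynamical systems over ℝ^d, as used in the paper.) Let (A, Θ) be a C*-dynamical system over ℝ^d. Then every smooth vector f ∈ A^∞ can be written as a finite sum f = Σ_{i=1}^m Θ_{Φ_i}(g_i) with Φ_1, …, Φ_m ∈ C_c^∞(ℝ^d) and g_1, …, g_m ∈ A. -/

import Mathlib

open MeasureTheory

/-- The set of smooth vectors of an action `Θ` of `ℝ^d` on a C*-algebra `A`. -/
def smoothVectors {A : Type*} [NonUnitalCStarAlgebra A] {d : ℕ}
    (Θ : (Fin d → ℝ) → A ≃⋆ₐ[ℂ] A) : Set A :=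
  {f : A | ContDiff ℝ (⊤ : ℕ∞) fun X : Fin d → ℝ => Θ X f}

open Filter Topology

section ExponentialAverage

variable {B : Type*} [NormedAddCommGroup B] [NormedSpace ℝ B]

/-- The average of `w` over `[0, c]` against the exponential weight `l * exp (-l * t)`. -/
noncomputable def expAverage (l c : ℝ) (w : ℝ → B) : B :=
  ∫ t in (0 : ℝ)..c, (l * Real.exp (-l * t)) • w t

/-- The convolution of `h` with the exponential weight truncated to `[0, c]`. -/
noncomputable def expConv (l c : ℝ) (h : ℝ → B) (x : ℝ) : B :=
  expAverage l c fun t => h (x - t)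

theorem norm_expAverage_le {l c C : ℝ} (hl : 0 < l) (hc : 0 < c) {w : ℝ → B}
    (hw : ∀ t, ‖w t‖ ≤ C) : ‖expAverage l c w‖ ≤ C := by
  have hC : 0 ≤ C := (norm_nonneg _).trans (hw 0)
  have hint : ∫ t in (0 : ℝ)..c, l * Real.exp (-l * t) * C = (1 - Real.exp (-l * c)) * C := by
    rw [intervalIntegral.integral_mul_const]
    congr 1
    have := intervalIntegral.integral_eq_sub_of_hasDerivAt (a := 0) (b := c)
      (f := fun t => -Real.exp (-l * t)) (f' := fun t => l * Real.exp (-l * t))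
      (fun t _ => by
        have := (((hasDerivAt_id t).const_mul (-l)).exp).neg
        simp only [id] at this
        exact this.congr_deriv (by ring))
      ((by fun_prop : Continuous fun t => l * Real.exp (-l * t)).intervalIntegrable _ _)
    rw [this]; simp; ring
  calc ‖expAverage l c w‖ ≤ ∫ t in (0 : ℝ)..c, l * Real.exp (-l * t) * C := by
        refine intervalIntegral.norm_integral_le_of_norm_le hc.le (ae_of_all _ fun t _ => ?_)
          ((by fun_prop : Continuous fun t => l * Real.exp (-l * t) * C).intervalIntegrable _ _)
        rw [norm_smul, Real.norm_of_nonneg (by positivity)]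
        gcongr
        exact hw t
    _ = (1 - Real.exp (-l * c)) * C := hint
    _ ≤ C := by nlinarith [Real.exp_pos (-l * c)]

theorem expAverage_sub_deriv [CompleteSpace B] {l c : ℝ} (hl : 0 < l) {w w' : ℝ → B}
    (hw : ∀ t, HasDerivAt w (w' t) t) (hw' : Continuous w') :
    expAverage l c (fun t => w t - l⁻¹ • w' t) = w 0 - Real.exp (-l * c) • w c := by
  have hwc : Continuous w := continuous_iff_continuousAt.2 fun t => (hw t).continuousAt
  have := intervalIntegral.integral_eq_sub_of_hasDerivAt (a := 0) (b := c)
    (f := fun t => -(Real.exp (-l * t) • w t))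
    (f' := fun t => (l * Real.exp (-l * t)) • (w t - l⁻¹ • w' t))
    (fun t _ => by
      have h1 := (((hasDerivAt_id t).const_mul (-l)).exp)
      simp only [id] at h1
      refine ((h1.smul (hw t)).neg).congr_deriv ?_
      rw [smul_sub, smul_smul]
      have : l * Real.exp (-l * t) * l⁻¹ = Real.exp (-l * t) := by field_simp
      rw [this]
      module)
    ((by fun_prop : Continuous fun t =>
      (l * Real.exp (-l * t)) • (w t - l⁻¹ • w' t)).intervalIntegrable _ _)
  rw [expAverage, this]
  simp
  abel

theorem expConv_eq_primitive {l c : ℝ} {h : ℝ → B} (hh : ∀ a b, IntervalIntegrable h volume a b) (x : ℝ) :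
    expConv l c h x = (l * Real.exp (-l * x)) •
      ((∫ s in (0 : ℝ)..x, Real.exp (l * s) • h s) -
        ∫ s in (0 : ℝ)..(x - c), Real.exp (l * s) • h s) := by
  have hi : ∀ a b : ℝ, IntervalIntegrable (fun s => Real.exp (l * s) • h s) volume a b :=
    fun a b => (hh a b).continuousOn_smul (by fun_prop)
  have e : (fun t => (l * Real.exp (-l * t)) • h (x - t)) =
      fun t => (fun s => (l * Real.exp (-l * x)) • (Real.exp (l * s) • h s)) (x - t) := by
    funext t
    simp only [smul_smul]
    rw [mul_assoc, ← Real.exp_add]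
    ring_nf
  rw [intervalIntegral.integral_interval_sub_left (hi _ _) (hi _ _), expConv, expAverage, e,
    intervalIntegral.integral_comp_sub_left
      (fun s => (l * Real.exp (-l * x)) • (Real.exp (l * s) • h s)),
    intervalIntegral.integral_smul, sub_zero]

theorem continuous_expConv {l c : ℝ} {h : ℝ → B} (hh : ∀ a b, IntervalIntegrable h volume a b) :
    Continuous (expConv l c h) := by
  have hi : ∀ a b : ℝ, IntervalIntegrable (fun s => Real.exp (l * s) • h s) volume a b :=
    fun a b => (hh a b).continuousOn_smul (by fun_prop)
  have hp := intervalIntegral.continuous_primitive hi 0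
  rw [show expConv l c h = _ from funext (expConv_eq_primitive hh)]
  exact (by fun_prop : Continuous fun x : ℝ => l * Real.exp (-l * x)).smul
    (hp.sub (hp.comp (by fun_prop : Continuous fun x : ℝ => x - c)))

theorem expConv_eq_zero {l c R : ℝ} (hc : 0 < c) {h : ℝ → B}
    (hs : ∀ x ∉ Set.Icc 0 R, h x = 0) : ∀ x ∉ Set.Icc 0 (R + c), expConv l c h x = 0 := by
  intro x hx
  refine intervalIntegral.integral_zero_ae (ae_of_all _ fun t ht => ?_)
  rw [Set.uIoc_of_le hc.le] at ht
  simp only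
  rw [hs (x - t), smul_zero]
  exact fun h' => hx ⟨by linarith [h'.1, ht.1], by linarith [h'.2, ht.2]⟩

variable [CompleteSpace B]

theorem contDiff_expConv {l c : ℝ} {n : ℕ} {h : ℝ → B} (hh : ContDiff ℝ n h) :
    ContDiff ℝ (n + 1 : ℕ) (expConv l c h) := by
  have hcs : ContDiff ℝ n fun s => Real.exp (l * s) • h s := by fun_prop
  have hd : ∀ x, HasDerivAt (fun x => ∫ s in (0 : ℝ)..x, Real.exp (l * s) • h s)
      (Real.exp (l * x) • h x) x := fun x => hcs.continuous.integral_hasStrictDerivAt 0 x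
      |>.hasDerivAt
  have hp : ContDiff ℝ (n + 1 : ℕ) fun x => ∫ s in (0 : ℝ)..x, Real.exp (l * s) • h s := by
    push_cast
    rw [contDiff_succ_iff_deriv]
    refine ⟨fun x => (hd x).differentiableAt, by simp, ?_⟩
    rwa [funext fun x => (hd x).deriv]
  rw [show expConv l c h = _ from funext (expConv_eq_primitive hh.continuous.intervalIntegrable)]
  exact (by fun_prop : ContDiff ℝ (n + 1 : ℕ) fun x : ℝ => l * Real.exp (-l * x)).smul
    (hp.sub (hp.comp (by fun_prop : ContDiff ℝ (n + 1 : ℕ) fun x : ℝ => x - c)))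

theorem expConv_add_deriv {l c : ℝ} (hl : 0 < l) {h : ℝ → B} (hh : ContDiff ℝ 1 h) (x : ℝ) :
    expConv l c h x + l⁻¹ • expConv l c (deriv h) x =
      h x - Real.exp (-l * c) • h (x - c) := by
  have hdc : Continuous (deriv h) := hh.continuous_deriv le_rfl
  have hc : Continuous h := hh.continuous
  have hd : ∀ t, HasDerivAt (fun t => h (x - t)) (-deriv h (x - t)) t := fun t =>
    ((hh.differentiable one_ne_zero (x - t)).hasDerivAt.comp_const_sub x t)
  have := expAverage_sub_deriv (c := c) hl hd (by fun_prop)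
  simp only [sub_zero] at this
  rw [← this, expConv, expConv, expAverage, expAverage, expAverage,
    ← intervalIntegral.integral_smul, ← intervalIntegral.integral_add]
  · refine intervalIntegral.integral_congr fun t _ => ?_
    module
  · exact (by fun_prop : Continuous _).intervalIntegrable _ _
  · exact (by fun_prop : Continuous _).intervalIntegrable _ _

theorem deriv_expConv {l c : ℝ} (hl : 0 < l) {h : ℝ → B} (hh : ContDiff ℝ 1 h) :
    deriv (expConv l c h) = expConv l c (deriv h) := by
  funext x
  have hcs : Continuous fun s => Real.exp (l * s) • h s :=
    (by fun_prop : Continuous fun s : ℝ => Real.exp (l * s)).smul hh.continuous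
  have hd : ∀ x, HasDerivAt (fun x => ∫ s in (0 : ℝ)..x, Real.exp (l * s) • h s)
      (Real.exp (l * x) • h x) x := fun x => hcs.integral_hasStrictDerivAt 0 x |>.hasDerivAt
  have hprim := fun x => expConv_eq_primitive (l := l) (c := c) hh.continuous.intervalIntegrable x
  have h1 := (((hasDerivAt_id x).const_mul (-l)).exp).const_mul l
  simp only [id] at h1
  have h2 := h1.smul ((hd x).sub ((hd (x - c)).comp_sub_const x c))
  have key : deriv (expConv l c h) x =
      l • (h x - Real.exp (-l * c) • h (x - c)) - l • expConv l c h x := by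
    rw [hprim x, show expConv l c h = _ from funext hprim]
    refine h2.deriv.trans ?_
    have e1 : Real.exp (-l * x) * Real.exp (l * x) = 1 := by
      rw [← Real.exp_add]; simp
    have e2 : Real.exp (-l * x) * Real.exp (l * (x - c)) = Real.exp (-l * c) := by
      rw [← Real.exp_add]; ring_nf
    simp only [smul_sub, smul_smul, Pi.sub_apply]
    rw [mul_assoc, mul_assoc l, e1, e2]
    module
  rw [key, ← expConv_add_deriv hl hh x, smul_add, smul_smul, mul_inv_cancel₀ hl.ne', one_smul]
  abel

theorem iteratedDeriv_expConv {l c : ℝ} (hl : 0 < l) (m : ℕ) {h : ℝ → B}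
    (hh : ContDiff ℝ m h) :
    iteratedDeriv m (expConv l c h) = expConv l c (iteratedDeriv m h) := by
  induction m generalizing h with
  | zero => simp
  | succ m ih =>
    rw [iteratedDeriv_succ', iteratedDeriv_succ', deriv_expConv hl (hh.of_le (by simp))]
    refine ih ?_
    push_cast at hh
    exact (contDiff_succ_iff_deriv.1 hh).2.2

theorem norm_expConv_sub_le {l c C C' : ℝ} (hl : 0 < l) (hc : 0 < c) {h : ℝ → B}
    (hh : ContDiff ℝ 1 h) (hC : ∀ x, ‖h x‖ ≤ C) (hC' : ∀ x, ‖deriv h x‖ ≤ C') (x : ℝ) :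
    ‖expConv l c h x - h x‖ ≤ Real.exp (-l * c) * C + l⁻¹ * C' := by
  have e : expConv l c h x - h x =
      -(Real.exp (-l * c) • h (x - c)) - l⁻¹ • expConv l c (deriv h) x := by
    rw [eq_sub_iff_add_eq, sub_add_eq_add_sub, expConv_add_deriv hl hh x]
    abel
  rw [e]
  refine (norm_sub_le _ _).trans ?_
  rw [norm_neg, norm_smul, norm_smul, Real.norm_of_nonneg (Real.exp_pos _).le,
    Real.norm_of_nonneg (inv_pos.2 hl).le]
  gcongr
  · exact hC _
  · exact norm_expAverage_le hl hc fun t => hC' _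

theorem tendsto_exp_neg_mul_add_inv {c : ℝ} (hc : 0 < c) (C C' : ℝ) :
    Tendsto (fun l : ℝ => Real.exp (-l * c) * C + l⁻¹ * C') atTop (𝓝 0) := by
  have h1 : Tendsto (fun l : ℝ => Real.exp (-l * c)) atTop (𝓝 0) := by
    have : Tendsto (fun l : ℝ => -(l * c)) atTop atBot :=
      tendsto_neg_atTop_atBot.comp (tendsto_id.atTop_mul_const hc)
    simpa only [neg_mul, Function.comp_def] using Real.tendsto_exp_atBot.comp this
  simpa using (h1.mul_const C).add (tendsto_inv_atTop_zero.mul_const C')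

theorem eventually_expConv_close {c δ : ℝ} (hc : 0 < c) (hδ : 0 < δ) {n m : ℕ} (hm : m < n)
    {h : ℝ → B} (hh : ContDiff ℝ n h) (hs : HasCompactSupport h) :
    ∀ᶠ l in atTop, ∀ x, ‖iteratedFDeriv ℝ m (expConv l c h - h) x‖ ≤ δ := by
  have hbound : ∀ k ≤ n, ∃ C, ∀ x, ‖iteratedDeriv k h x‖ ≤ C := fun k hk => by
    obtain ⟨C, hC⟩ := (hs.iteratedFDeriv (𝕜 := ℝ) k).exists_bound_of_continuous
      (hh.continuous_iteratedFDeriv (by exact_mod_cast hk))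
    exact ⟨C, fun x => by simpa [norm_iteratedFDeriv_eq_norm_iteratedDeriv] using hC x⟩
  obtain ⟨C, hC⟩ := hbound m hm.le
  obtain ⟨C', hC'⟩ := hbound (m + 1) hm
  filter_upwards [eventually_gt_atTop 0,
    (tendsto_exp_neg_mul_add_inv hc C C').eventually_le_const hδ] with l hl hlδ x
  have hm' : ContDiff ℝ m h := hh.of_le (by exact_mod_cast hm.le)
  have hK : ContDiff ℝ m (expConv l c h) := (contDiff_expConv hm').of_le (by simp)
  rw [norm_iteratedFDeriv_eq_norm_iteratedDeriv, iteratedDeriv_sub hK.contDiffAt hm'.contDiffAt,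
    iteratedDeriv_expConv hl m hm']
  refine (norm_expConv_sub_le hl hc ?_ hC (fun x => ?_) x).trans hlδ
  · rw [iteratedDeriv_eq_iterate]
    exact ContDiff.iterate_deriv' 1 m (hh.of_le (by norm_cast; omega))
  · rw [← iteratedDeriv_succ]; exact hC' x

end ExponentialAverage

/-- Dependent choice along a family of predicates indexed by `ℕ`. -/
theorem exists_seq_of_step {α : Type*} {P : ℕ → α → Prop} {r : ℕ → α → α → Prop}
    (hbase : ∃ a, P 0 a) (hstep : ∀ n a, P n a → ∃ b, P (n + 1) b ∧ r n a b) :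
    ∃ s : ℕ → α, (∀ n, P n (s n)) ∧ ∀ n, r n (s n) (s (n + 1)) := by
  choose! next hP hr using hstep
  obtain ⟨a, ha⟩ := hbase
  let s : ℕ → α := fun n => Nat.rec a next n
  have hs : ∀ n, P n (s n) := fun n => by
    induction n with
    | zero => exact ha
    | succ n ih => exact hP n _ ih
  exact ⟨s, hs, fun n => hr n _ (hs n)⟩

/-- A sequence of increasingly regular functions whose successive differences are geometrically
small in all derivatives has a smooth limit. -/
theorem exists_smooth_limit {E B : Type*} [NormedAddCommGroup E] [NormedSpace ℝ E]
    [NormedAddCommGroup B] [NormedSpace ℝ B] [CompleteSpace B] {u : ℕ → E → B}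
    (hu : ∀ n : ℕ, ContDiff ℝ n (u n))
    (hclose : ∀ n, ∀ m < n, ∀ x,
      ‖iteratedFDeriv ℝ m (u (n + 1) - u n) x‖ ≤ (1 / 2 : ℝ) ^ n) :
    ∃ w : E → B, ContDiff ℝ (⊤ : ℕ∞) w ∧ (∀ x, Tendsto (fun n => u n x) atTop (𝓝 (w x))) ∧
      ∀ n x, ‖u (n + 1) x - w x‖ ≤ 2 := by
  have hgeom : Summable fun n : ℕ => (1 / 2 : ℝ) ^ n := summable_geometric_two
  have hsum : ∀ x m, Summable fun n => u (n + (m + 1) + 1) x - u (n + (m + 1)) x := fun x m => by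
    refine Summable.of_norm_bounded ((summable_nat_add_iff (m + 1)).2 hgeom) fun n => ?_
    simpa using hclose (n + (m + 1)) 0 (by omega) x
  have hlim : ∀ x m, Tendsto (fun n => u n x) atTop
      (𝓝 (u (m + 1) x + ∑' n, (u (n + (m + 1) + 1) x - u (n + (m + 1)) x))) := fun x m => by
    rw [← tendsto_add_atTop_iff_nat (m + 1)]
    have h := ((hsum x m).hasSum.tendsto_sum_nat).const_add (u (m + 1) x)
    refine h.congr fun n => ?_
    have := Finset.sum_range_sub (fun k => u (k + (m + 1)) x) n
    simp only [zero_add] at this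
    rw [show (fun k => u (k + (m + 1) + 1) x - u (k + (m + 1)) x) =
      fun k => u (k + 1 + (m + 1)) x - u (k + (m + 1)) x by
        funext k; rw [add_right_comm], this]
    abel
  refine ⟨fun x => u (0 + 1) x + ∑' n, (u (n + (0 + 1) + 1) x - u (n + (0 + 1)) x),
    contDiff_infty.2 fun m => ?_, fun x => hlim x 0, fun n x => ?_⟩
  swap
  · have h := dist_le_of_le_geometric_of_tendsto (1 / 2) 1 (by norm_num)
      (f := fun n => u (n + 1) x) (fun k => by
        have h := hclose (k + 1) 0 (by omega) x
        rw [norm_iteratedFDeriv_zero] at h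
        rw [dist_comm, dist_eq_norm, one_mul]
        exact h.trans (pow_le_pow_of_le_one (by norm_num) (by norm_num) (by omega)))
      ((tendsto_add_atTop_iff_nat 1).2 (hlim x 0)) n
    rw [dist_eq_norm] at h
    refine h.trans ?_
    have : (1 / 2 : ℝ) ^ n ≤ 1 := pow_le_one₀ (by norm_num) (by norm_num)
    rw [div_le_iff₀ (by norm_num)]
    linarith
  rw [funext fun x => tendsto_nhds_unique (hlim x 0) (hlim x m)]
  have hreg : ∀ n, m ≤ n → ContDiff ℝ m (u n) := fun n hn => (hu n).of_le (by exact_mod_cast hn)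
  refine (hreg _ (by omega)).add ?_
  refine contDiff_tsum (N := (m : ℕ∞)) (v := fun _ n => (1 / 2 : ℝ) ^ (n + (m + 1)))
    (fun n => (hreg _ (by omega)).sub (hreg _ (by omega)))
    (fun k _ => (summable_nat_add_iff (m + 1)).2 hgeom) fun k n x hk => ?_
  have hk' : k ≤ m := by exact_mod_cast hk
  exact hclose (n + (m + 1)) k (by omega) x

/-- A strongly continuous isometric representation of an additive group on a normed space. -/
structure IsIsometricRep {E B : Type*} [NormedAddCommGroup E] [NormedAddCommGroup B]
    [NormedSpace ℂ B] (U : E → B →L[ℂ] B) : Prop where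
  add_apply : ∀ X Y a, U (X + Y) a = U X (U Y a)
  zero_apply : ∀ a, U 0 a = a
  norm_apply : ∀ X a, ‖U X a‖ = ‖a‖
  continuous_orbit : ∀ a, Continuous fun X => U X a

theorem norm_iteratedFDeriv_clm_comp_le {E B : Type*} [NormedAddCommGroup E] [NormedSpace ℝ E]
    [NormedAddCommGroup B] [NormedSpace ℂ B] (N : B →L[ℂ] B) {F : E → B}
    (hF : ContDiff ℝ (⊤ : ℕ∞) F) (m : ℕ) (X : E) :
    ‖iteratedFDeriv ℝ m (fun Y => N (F Y)) X‖ ≤ ‖N‖ * ‖iteratedFDeriv ℝ m F X‖ := by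
  have h := (N.restrictScalars ℝ).iteratedFDeriv_comp_left (i := m) (x := X) hF.contDiffAt
    (by exact_mod_cast le_top)
  have h' := (N.restrictScalars ℝ).norm_compContinuousMultilinearMap_le (iteratedFDeriv ℝ m F X)
  rw [← h, ContinuousLinearMap.norm_restrictScalars] at h'
  exact h'

namespace IsIsometricRep

variable {E B : Type*} [NormedAddCommGroup E] [NormedAddCommGroup B] [NormedSpace ℂ B]
  {U : E → B →L[ℂ] B}

theorem norm_le_one (hU : IsIsometricRep U) (X : E) : ‖U X‖ ≤ 1 :=
  ContinuousLinearMap.opNorm_le_bound _ zero_le_one fun a => by rw [hU.norm_apply, one_mul]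

theorem commute (hU : IsIsometricRep U) (X Y : E) : Commute (U X) (U Y) := by
  ext a
  simp only [mul_apply_eq_comp]
  rw [← hU.add_apply, ← hU.add_apply, add_comm]

variable [NormedSpace ℝ E]

theorem norm_iteratedFDeriv_orbit_le (hU : IsIsometricRep U) {f : B}
    (hf : ContDiff ℝ (⊤ : ℕ∞) fun X => U X f) (m : ℕ) (X : E) :
    ‖iteratedFDeriv ℝ m (fun Y => U Y f) X‖ ≤ ‖iteratedFDeriv ℝ m (fun Y => U Y f) 0‖ := by
  have h := norm_iteratedFDeriv_clm_comp_le (U X) hf m 0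
  simp only [← hU.add_apply] at h
  rw [iteratedFDeriv_comp_add_left (f := fun Y => U Y f), add_zero] at h
  exact h.trans (mul_le_of_le_one_left (norm_nonneg _) (hU.norm_le_one X))

/-- The derivative of a smooth vector in the direction `v` is implemented by a smooth vector. -/
theorem exists_deriv (hU : IsIsometricRep U) {f : B}
    (hf : ContDiff ℝ (⊤ : ℕ∞) fun X => U X f) (v : E) :
    ∃ f' : B, (ContDiff ℝ (⊤ : ℕ∞) fun X => U X f') ∧
      ∀ t : ℝ, HasDerivAt (fun t : ℝ => U (t • v) f) (U (t • v) f') t := by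
  have hd : Differentiable ℝ fun X => U X f := hf.differentiable (by simp)
  have key : ∀ X, fderiv ℝ (fun Y => U Y f) X v = U X (fderiv ℝ (fun Y => U Y f) 0 v) := by
    intro X
    have h1 : HasFDerivAt (fun Y => U X (U Y f))
        (((U X).restrictScalars ℝ).comp (fderiv ℝ (fun Y => U Y f) 0)) 0 :=
      ((U X).restrictScalars ℝ).hasFDerivAt.comp 0 (hd 0).hasFDerivAt
    have h2 : HasFDerivAt (fun Y => U (X + Y) f) (fderiv ℝ (fun Y => U Y f) X) 0 := by
      have h3 : HasFDerivAt (fun Y => U Y f) (fderiv ℝ (fun Y => U Y f) X) (X + 0) := by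
        rw [add_zero]; exact (hd X).hasFDerivAt
      exact (hasFDerivAt_comp_add_left X).2 h3
    simp only [← hU.add_apply] at h1
    rw [h2.unique h1]
    rfl
  refine ⟨fderiv ℝ (fun Y => U Y f) 0 v, ?_, fun t => ?_⟩
  · simp only [← key]
    exact (hf.fderiv_right (m := (⊤ : ℕ∞)) (by simp)).clm_apply contDiff_const
  · rw [← key]
    have hl : HasDerivAt (fun t : ℝ => t • v) v t := by
      simpa using (hasDerivAt_id t).smul_const v
    exact (hd (t • v)).hasFDerivAt.comp_hasDerivAt t hl

variable [CompleteSpace B]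

/-- Exponential averaging along a one-parameter subgroup is inverted on smooth vectors by an
operator tending to the identity as the rate tends to infinity. -/
theorem eventually_exists_expAverage_eq (hU : IsIsometricRep U) {f : B}
    (hf : ContDiff ℝ (⊤ : ℕ∞) fun X => U X f) (v : E) {c δ : ℝ} (hc : 0 < c) (hδ : 0 < δ)
    (n : ℕ) :
    ∀ᶠ l in atTop, ∃ g : B, (ContDiff ℝ (⊤ : ℕ∞) fun X => U X g) ∧
      expAverage l c (fun t => U (t • v) g) = f ∧
      ∀ m < n, ∀ X, ‖iteratedFDeriv ℝ m ((fun X => U X g) - fun X => U X f) X‖ ≤ δ := by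
  obtain ⟨f', hf', hdf⟩ := hU.exists_deriv hf v
  set ε : ℝ → ℂ := fun l => (Real.exp (-l * c) : ℂ) with hε
  set N : ℝ → (B →L[ℂ] B) := fun l => Ring.inverse (1 - ε l • U (c • v)) with hN
  have hε0 : Tendsto ε atTop (𝓝 0) := by
    have := tendsto_exp_neg_mul_add_inv hc 1 0
    simp only [mul_one, mul_zero, add_zero] at this
    simpa only [Complex.ofReal_zero, Function.comp_def] using
      (Complex.continuous_ofReal.tendsto 0).comp this
  have hN1 : Tendsto N atTop (𝓝 1) := by
    have h1 : Tendsto (fun l => 1 - ε l • U (c • v)) atTop (𝓝 ((1 : (B →L[ℂ] B)ˣ) : B →L[ℂ] B)) := by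
      simpa using (hε0.smul_const (U (c • v))).const_sub 1
    simpa only [Units.val_one, Ring.inverse_one, Function.comp_def] using
      (NormedRing.inverse_continuousAt (1 : (B →L[ℂ] B)ˣ)).tendsto.comp h1
  have hsmall : ∀ m, Tendsto (fun l => ‖N l - 1‖ * ‖iteratedFDeriv ℝ m (fun X => U X f) 0‖ +
      l⁻¹ * (‖N l‖ * ‖iteratedFDeriv ℝ m (fun X => U X f') 0‖)) atTop (𝓝 0) := fun m => by
    simpa using ((hN1.sub_const 1).norm.mul_const _).add
      (tendsto_inv_atTop_zero.mul (hN1.norm.mul_const _))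
  have hev : ∀ᶠ l in atTop, ∀ m ∈ Finset.range n,
      ‖N l - 1‖ * ‖iteratedFDeriv ℝ m (fun X => U X f) 0‖ +
      l⁻¹ * (‖N l‖ * ‖iteratedFDeriv ℝ m (fun X => U X f') 0‖) ≤ δ :=
    (Finset.eventually_all _).2 fun m _ => (hsmall m).eventually_le_const hδ
  filter_upwards [eventually_gt_atTop 0, hev] with l hl hlδ
  have hlt : ‖ε l • U (c • v)‖ < 1 := by
    have h1 : Real.exp (-l * c) < 1 := by rw [Real.exp_lt_one_iff]; nlinarith
    have h2 : ‖ε l‖ = Real.exp (-l * c) := by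
      rw [hε, Complex.norm_real, Real.norm_of_nonneg (Real.exp_pos _).le]
    rw [norm_smul, h2]
    exact (mul_le_of_le_one_right (Real.exp_pos _).le (hU.norm_le_one _)).trans_lt h1
  have hunit := isUnit_one_sub_of_norm_lt_one hlt
  have hinv : (1 - ε l • U (c • v)) * N l = 1 := Ring.mul_inverse_cancel _ hunit
  have hcomm : ∀ X a, U X (N l a) = N l (U X a) := fun X a => by
    have h : Commute (U X) (1 - ε l • U (c • v)) :=
      (Commute.one_right _).sub_right ((hU.commute X _).smul_right _)
    obtain ⟨w, hw⟩ := hunit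
    have h' : Commute (U X) (N l) := by
      rw [← hw] at h
      simp only [hN, ← hw, Ring.inverse_unit]
      exact h.units_inv_right
    exact DFunLike.congr_fun h'.eq a
  have hsm : ∀ {a : B}, (ContDiff ℝ (⊤ : ℕ∞) fun X => U X a) →
      ContDiff ℝ (⊤ : ℕ∞) fun X => N l (U X a) := fun ha =>
    ((N l).restrictScalars ℝ).contDiff.comp ha
  have horb : ∀ X, U X (N l f - l⁻¹ • N l f') = N l (U X f) - l⁻¹ • N l (U X f') := fun X => by
    rw [map_sub, ← Complex.coe_smul, map_smul, hcomm, hcomm, Complex.coe_smul]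
  refine ⟨N l f - l⁻¹ • N l f', ?_, ?_, fun m hm X => ?_⟩
  · simp only [horb]
    exact (hsm hf).sub ((hsm hf').const_smul _)
  · have hd : ∀ t : ℝ, HasDerivAt (fun t : ℝ => N l (U (t • v) f)) (N l (U (t • v) f')) t :=
      fun t => ((N l).restrictScalars ℝ).hasFDerivAt.comp_hasDerivAt t (hdf t)
    have hcd : Continuous fun t : ℝ => N l (U (t • v) f') :=
      (N l).continuous.comp ((hU.continuous_orbit f').comp (by fun_prop))
    simp only [horb]
    rw [expAverage_sub_deriv hl hd hcd, zero_smul, hU.zero_apply, ← hcomm, ← Complex.coe_smul]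
    exact DFunLike.congr_fun hinv f
  · have e : ((fun X => U X (N l f - l⁻¹ • N l f')) - fun X => U X f) =
        (fun X => (N l - 1) (U X f)) - (fun X => l⁻¹ • N l (U X f')) := by
      funext X
      simp only [Pi.sub_apply, horb]
      simp
      abel
    have hmt : (m : WithTop ℕ∞) ≤ ((⊤ : ℕ∞) : WithTop ℕ∞) := by exact_mod_cast le_top
    have hs1 : ContDiff ℝ (⊤ : ℕ∞) fun X => (N l - 1) (U X f) :=
      ((N l - 1).restrictScalars ℝ).contDiff.comp hf
    have hs2 := (hsm hf').of_le hmt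
    rw [e, iteratedFDeriv_sub (hs1.of_le hmt) (hs2.const_smul l⁻¹), Pi.sub_apply,
      show (fun X => l⁻¹ • N l (U X f')) = l⁻¹ • fun X => N l (U X f') from rfl,
      iteratedFDeriv_const_smul_apply hs2.contDiffAt]
    refine (norm_sub_le _ _).trans (le_trans ?_ (hlδ m (Finset.mem_range.2 hm)))
    rw [norm_smul, Real.norm_of_nonneg (inv_pos.2 hl).le]
    gcongr
    · exact (norm_iteratedFDeriv_clm_comp_le _ hf m X).trans
        (by gcongr; exact hU.norm_iteratedFDeriv_orbit_le hf m X)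
    · exact (norm_iteratedFDeriv_clm_comp_le _ hf' m X).trans
        (by gcongr; exact hU.norm_iteratedFDeriv_orbit_le hf' m X)

end IsIsometricRep

namespace IsIsometricRep

variable {E B : Type*} [NormedAddCommGroup E] [NormedSpace ℝ E]
  [NormedAddCommGroup B] [NormedSpace ℂ B] [CompleteSpace B] {U : E → B →L[ℂ] B}

theorem integral_expConv_smul (hU : IsIsometricRep U) {h : ℝ → ℂ} (hh : Integrable h) (v : E)
    {l c : ℝ} (hc : 0 < c) (g : B) :
    ∫ x, expConv l c h x • U (x • v) g =
      ∫ x, h x • U (x • v) (expAverage l c fun t => U (t • v) g) := by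
  set k : ℝ → ℝ := fun t => l * Real.exp (-l * t) with hk
  have hkc : Continuous k := by fun_prop
  set ν : Measure ℝ := volume.restrict (Set.Ioc 0 c)
  have hkν : Integrable k ν :=
    (intervalIntegrable_iff_integrableOn_Ioc_of_le hc.le).1 (hkc.intervalIntegrable 0 c)
  have hUc : Continuous fun x : ℝ => U (x • v) g :=
    (hU.continuous_orbit g).comp (by fun_prop)
  have hint : Integrable (fun p : ℝ × ℝ => (k p.2 • h (p.1 - p.2)) • U (p.1 • v) g)
      (volume.prod ν) := by
    refine Integrable.smul_bdd (φ := fun p : ℝ × ℝ => k p.2 • h (p.1 - p.2)) ?_ ‖g‖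
      (hUc.comp continuous_fst).aestronglyMeasurable
      (ae_of_all _ fun p => (hU.norm_apply _ _).le)
    exact Integrable.convolution_integrand (ContinuousLinearMap.lsmul ℝ ℝ) hkν hh
  have hint' : Integrable (fun p : ℝ × ℝ => (k p.2 • h p.1) • U ((p.1 + p.2) • v) g)
      (volume.prod ν) := by
    refine Integrable.smul_bdd (φ := fun p : ℝ × ℝ => k p.2 • h p.1) ?_ ‖g‖
      (hUc.comp (continuous_fst.add continuous_snd)).aestronglyMeasurable
      (ae_of_all _ fun p => (hU.norm_apply _ _).le)
    refine (hh.mul_prod hkν.ofReal).congr (ae_of_all _ fun p => ?_)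
    simp [mul_comm]
  calc ∫ x, expConv l c h x • U (x • v) g
      = ∫ x, ∫ t, (k t • h (x - t)) • U (x • v) g ∂ν := by
        congr 1 with x
        rw [integral_smul_const, expConv, expAverage, intervalIntegral.integral_of_le hc.le]
    _ = ∫ t, (∫ x, (k t • h (x - t)) • U (x • v) g) ∂ν := integral_integral_swap hint
    _ = ∫ t, (∫ x, (k t • h x) • U ((x + t) • v) g) ∂ν := by
        congr 1 with t
        rw [← integral_add_right_eq_self _ t]
        simp only [add_sub_cancel_right]
    _ = ∫ x, ∫ t, (k t • h x) • U ((x + t) • v) g ∂ν := (integral_integral_swap hint').symm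
    _ = ∫ x, h x • U (x • v) (expAverage l c fun t => U (t • v) g) := by
        congr 1 with x
        rw [expAverage, intervalIntegral.integral_of_le hc.le,
          ← ContinuousLinearMap.integral_comp_comm, ← integral_smul]
        · congr 1 with t
          rw [add_smul, hU.add_apply, ContinuousLinearMap.map_smul_of_tower, Complex.real_smul,
            mul_comm, mul_smul, Complex.coe_smul]
        · exact (intervalIntegrable_iff_integrableOn_Ioc_of_le hc.le).1
            ((hkc.smul hUc).intervalIntegrable 0 c)

/-- Every smooth vector is averaged from a smooth vector along a given one-parameter subgroup,
against a smooth compactly supported weight. -/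
theorem exists_integral_line_eq (hU : IsIsometricRep U) {f : B}
    (hf : ContDiff ℝ (⊤ : ℕ∞) fun X => U X f) (v : E) :
    ∃ (ψ : ℝ → ℂ) (g : B), ContDiff ℝ (⊤ : ℕ∞) ψ ∧ HasCompactSupport ψ ∧
      (ContDiff ℝ (⊤ : ℕ∞) fun X => U X g) ∧ f = ∫ t, ψ t • U (t • v) g := by
  have hsupp : ∀ {h : ℝ → ℂ} {R : ℝ}, (∀ x ∉ Set.Icc 0 R, h x = 0) → HasCompactSupport h :=
    fun hR => HasCompactSupport.intro isCompact_Icc hR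
  obtain ⟨s, hP, hr⟩ := exists_seq_of_step (α := (ℝ → ℂ) × B)
    (P := fun n p => ContDiff ℝ n p.1 ∧ (∀ x ∉ Set.Icc (0 : ℝ) (4 - 2 * (1 / 2) ^ n), p.1 x = 0) ∧
      (ContDiff ℝ (⊤ : ℕ∞) fun X => U X p.2) ∧ ∫ x, p.1 x • U (x • v) p.2 = f)
    (r := fun n p q => (∀ m < n, ∀ x, ‖iteratedFDeriv ℝ m (q.1 - p.1) x‖ ≤ (1 / 2 : ℝ) ^ n) ∧
      ∀ m < n, ∀ X,
        ‖iteratedFDeriv ℝ m ((fun X => U X q.2) - fun X => U X p.2) X‖ ≤ (1 / 2 : ℝ) ^ n)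
    (by
      obtain ⟨l, g, hg, hgf, -⟩ :=
        (hU.eventually_exists_expAverage_eq hf v one_pos one_pos 0).exists
      obtain ⟨l', g', hg', hgg', -⟩ :=
        (hU.eventually_exists_expAverage_eq hg v one_pos one_pos 0).exists
      set h : ℝ → ℂ := (Set.Ioc (0 : ℝ) 1).indicator
        fun t => ((l * Real.exp (-l * t) : ℝ) : ℂ) with hh
      have hi : Integrable h := by
        rw [hh, integrable_indicator_iff measurableSet_Ioc]
        exact (intervalIntegrable_iff_integrableOn_Ioc_of_le zero_le_one).1
          ((by fun_prop : Continuous _).intervalIntegrable 0 1)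
      refine ⟨(expConv l' 1 h, g'), ?_, ?_, hg', ?_⟩
      · exact contDiff_zero.2 (continuous_expConv fun a b => hi.intervalIntegrable)
      · have := expConv_eq_zero (l := l') (R := 1) (h := h) one_pos fun x hx =>
          Set.indicator_of_notMem (fun hx' => hx (Set.Ioc_subset_Icc_self hx')) _
        norm_num at this ⊢
        exact this
      · simp only
        rw [hU.integral_expConv_smul hi v one_pos, hgg', ← hgf, expAverage,
          intervalIntegral.integral_of_le zero_le_one, ← integral_indicator measurableSet_Ioc]
        congr 1 with t
        by_cases ht : t ∈ Set.Ioc (0 : ℝ) 1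
        · simp only [hh, Set.indicator_of_mem ht, Complex.coe_smul]
        · simp only [hh, Set.indicator_of_notMem ht, zero_smul])
    (by
      rintro n ⟨h, g⟩ ⟨hh, hR, hg, hgf⟩
      have hδ : (0 : ℝ) < (1 / 2) ^ n := by positivity
      have hc := hsupp hR
      have hev : ∀ᶠ l in atTop, ∀ m ∈ Finset.range n, ∀ x,
          ‖iteratedFDeriv ℝ m (expConv l ((1 / 2) ^ n) h - h) x‖ ≤ (1 / 2 : ℝ) ^ n :=
        (Finset.eventually_all _).2 fun m hm =>
          eventually_expConv_close hδ hδ (Finset.mem_range.1 hm) hh hc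
      obtain ⟨l, ⟨g', hg', hgg', hclose⟩, hl⟩ :=
        ((hU.eventually_exists_expAverage_eq hg v hδ hδ n).and hev).exists
      refine ⟨(expConv l ((1 / 2) ^ n) h, g'), ⟨contDiff_expConv hh, ?_, hg', ?_⟩,
        fun m hm => hl m (Finset.mem_range.2 hm), hclose⟩
      · have := expConv_eq_zero (l := l) hδ hR
        rwa [show (4 : ℝ) - 2 * (1 / 2) ^ n + (1 / 2) ^ n = 4 - 2 * (1 / 2) ^ (n + 1) by ring]
          at this
      · simp only
        rw [hU.integral_expConv_smul (hh.continuous.integrable_of_hasCompactSupport hc) v hδ,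
          hgg', hgf])
  obtain ⟨ψ, hψ, hψlim, hψb⟩ := exists_smooth_limit (fun n => (hP n).1) fun n => (hr n).1
  obtain ⟨w, hw, hwlim, hwb⟩ := exists_smooth_limit (u := fun n X => U X (s n).2)
    (fun n => (hP n).2.2.1.of_le (by exact_mod_cast le_top)) fun n => (hr n).2
  have hzero : ∀ n, ∀ x ∉ Set.Icc (0 : ℝ) 4, (s n).1 x = 0 := fun n x hx =>
    (hP n).2.1 x fun hx' => hx ⟨hx'.1, hx'.2.trans (by
      have : (0 : ℝ) < (1 / 2) ^ n := by positivity
      linarith)⟩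
  have hψ0 : ∀ x ∉ Set.Icc (0 : ℝ) 4, ψ x = 0 := fun x hx =>
    tendsto_nhds_unique (hψlim x) (by simp only [hzero _ x hx, tendsto_const_nhds])
  have hlim0 : Tendsto (fun n => (s n).2) atTop (𝓝 (w 0)) := by
    simpa only [hU.zero_apply] using hwlim 0
  have hworb : ∀ X, w X = U X (w 0) := fun X =>
    tendsto_nhds_unique (hwlim X) (((U X).continuous.tendsto _).comp hlim0)
  refine ⟨ψ, w 0, hψ, hsupp hψ0, by simpa only [← hworb] using hw, ?_⟩
  obtain ⟨C, hC⟩ := (hsupp hψ0).exists_bound_of_continuous hψ.continuous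
  have hC0 : 0 ≤ C := (norm_nonneg _).trans (hC 0)
  refine tendsto_nhds_unique (f := fun n => ∫ x, (s (n + 1)).1 x • U (x • v) (s (n + 1)).2)
    (l := atTop) ?_ ?_
  · simp only [fun n => (hP (n + 1)).2.2.2, tendsto_const_nhds]
  · refine tendsto_integral_of_dominated_convergence
      ((Set.Icc (0 : ℝ) 4).indicator fun _ => (C + 2) * (‖w 0‖ + 2)) (fun n => ?_) ?_
      (fun n => ae_of_all _ fun x => ?_) (ae_of_all _ fun x => ?_)
    · exact ((hP (n + 1)).1.continuous.smul
        ((hU.continuous_orbit _).comp (by fun_prop : Continuous fun x : ℝ => x • v)))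
        |>.aestronglyMeasurable
    · rw [integrable_indicator_iff measurableSet_Icc]
      exact integrableOn_const (by simp)
    · by_cases hx : x ∈ Set.Icc (0 : ℝ) 4
      · rw [Set.indicator_of_mem hx, norm_smul, hU.norm_apply]
        have h1 := norm_le_norm_add_norm_sub' ((s (n + 1)).1 x) (ψ x)
        have h2 := norm_le_norm_add_norm_sub' (s (n + 1)).2 (w 0)
        have h3 := hwb n 0
        simp only [hU.zero_apply] at h3
        gcongr
        · linarith [hψb n x, hC x]
        · linarith
      · rw [Set.indicator_of_notMem hx, hzero _ x hx, zero_smul, norm_zero]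
    · have h := (hψlim x).smul (hwlim (x • v))
      rw [hworb] at h
      exact (tendsto_add_atTop_iff_nat 1).2 h

/-- Every smooth vector is averaged from a smooth vector over the span of finitely many
directions, against a smooth compactly supported weight. -/
theorem exists_integral_pi_eq (hU : IsIsometricRep U) {n : ℕ} (v : Fin n → E) {f : B}
    (hf : ContDiff ℝ (⊤ : ℕ∞) fun X => U X f) :
    ∃ (Φ : (Fin n → ℝ) → ℂ) (g : B), ContDiff ℝ (⊤ : ℕ∞) Φ ∧ HasCompactSupport Φ ∧
      (ContDiff ℝ (⊤ : ℕ∞) fun X => U X g) ∧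
      f = ∫ Y : Fin n → ℝ, Φ Y • U (∑ i, Y i • v i) g := by
  induction n generalizing f with
  | zero =>
    refine ⟨fun _ => 1, f, contDiff_const, HasCompactSupport.of_compactSpace _, hf, ?_⟩
    simp [integral_unique, hU.zero_apply, Measure.real, volume_pi]
  | succ n ih =>
    obtain ⟨ψ, g₁, hψ, hψs, hg₁, rfl⟩ := hU.exists_integral_line_eq hf (v 0)
    obtain ⟨Φ, g, hΦ, hΦs, hg, rfl⟩ := ih (fun i => v i.succ) hg₁
    have hcons : Continuous fun p : ℝ × (Fin n → ℝ) => (Fin.cons p.1 p.2 : Fin (n + 1) → ℝ) :=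
      Continuous.finCons (A := fun _ => ℝ) continuous_fst continuous_snd
    refine ⟨fun Y => ψ (Y 0) * Φ fun i => Y i.succ, g, ?_, ?_, hg, ?_⟩
    · exact (hψ.comp (by fun_prop)).mul (hΦ.comp (by fun_prop))
    · refine HasCompactSupport.intro ((hψs.isCompact.prod hΦs.isCompact).image hcons)
        fun Y hY => ?_
      by_contra h0
      refine hY ⟨(Y 0, fun i => Y i.succ), ⟨subset_tsupport _ (left_ne_zero_of_mul h0),
        subset_tsupport _ (right_ne_zero_of_mul h0)⟩, ?_⟩
      exact Fin.cons_self_tail Y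
    · set G : ℝ × (Fin n → ℝ) → B := fun p =>
        (ψ p.1 * Φ p.2) • U (p.1 • v 0 + ∑ i, p.2 i • v i.succ) g with hG
      have hint : Integrable G (volume.prod volume) := by
        refine Integrable.smul_bdd (φ := fun p : ℝ × (Fin n → ℝ) => ψ p.1 * Φ p.2) ?_ ‖g‖
          ((hU.continuous_orbit g).comp (by fun_prop)).aestronglyMeasurable
          (ae_of_all _ fun p => (hU.norm_apply _ _).le)
        exact (hψ.continuous.integrable_of_hasCompactSupport hψs).mul_prod
          (hΦ.continuous.integrable_of_hasCompactSupport hΦs)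
      have hfub : ∫ p, G p = ∫ t, ψ t • U (t • v 0)
          (∫ Y : Fin n → ℝ, Φ Y • U (∑ i, Y i • v i.succ) g) := by
        rw [Measure.volume_eq_prod, integral_prod _ hint]
        congr 1 with t
        rw [← ContinuousLinearMap.integral_comp_comm, ← integral_smul]
        · congr 1 with Y
          rw [hG, map_smul, ← hU.add_apply, smul_smul]
        · refine Integrable.smul_bdd (φ := Φ)
            (hΦ.continuous.integrable_of_hasCompactSupport hΦs) ‖g‖
            ((hU.continuous_orbit g).comp (by fun_prop)).aestronglyMeasurable
            (ae_of_all _ fun p => (hU.norm_apply _ _).le)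
      rw [← hfub, ← (volume_preserving_piFinSuccAbove (fun _ : Fin (n + 1) => ℝ) 0).integral_comp']
      congr 1 with Y
      rw [Fin.sum_univ_succ]
      rfl

end IsIsometricRep

/-- (Dixmier–Malliavin theorem for C*-dynamical systems over `ℝ^d`.)
Let `(A, Θ)` be a C*-dynamical system over `ℝ^d`.  Then every smooth vector `f ∈ A^∞` can be
written as a finite sum `f = Σ_{i=1}^m Θ_{Φ_i}(g_i)` with `Φ_1, …, Φ_m ∈ C_c^∞(ℝ^d)` and
`g_1, …, g_m ∈ A`, where `Θ_Φ(g) = ∫ Φ(Y) Θ_Y(g) dY`. -/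
theorem dixmier_malliavin
    {A : Type*} [NonUnitalCStarAlgebra A] {d : ℕ}
    (Θ : (Fin d → ℝ) → A ≃⋆ₐ[ℂ] A)
    (hadd : ∀ (X Y : Fin d → ℝ) (a : A), Θ (X + Y) a = Θ X (Θ Y a))
    (hzero : ∀ a : A, Θ 0 a = a)
    (hcont : ∀ a : A, Continuous fun X : Fin d → ℝ => Θ X a) :
    ∀ f ∈ smoothVectors Θ,
      ∃ (m : ℕ) (Φ : Fin m → (Fin d → ℝ) → ℂ) (g : Fin m → A),
        (∀ i, ContDiff ℝ (⊤ : ℕ∞) (Φ i)) ∧ (∀ i, HasCompactSupport (Φ i)) ∧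
        f = ∑ i, ∫ Y : Fin d → ℝ, Φ i Y • Θ Y (g i) := by
  intro f hf
  let U : (Fin d → ℝ) → A →L[ℂ] A := fun X =>
    LinearMap.mkContinuous
      { toFun := Θ X, map_add' := map_add (Θ X), map_smul' := fun z a => map_smul (Θ X) z a } 1
      fun a => by simp [StarAlgEquiv.norm_map]
  have hU : IsIsometricRep U :=
    ⟨hadd, hzero, fun X a => StarAlgEquiv.norm_map (Θ X) a, hcont⟩
  obtain ⟨Φ, g, hΦ, hΦs, -, hfg⟩ :=
    hU.exists_integral_pi_eq (fun i : Fin d => Pi.single i (1 : ℝ)) (f := f) hf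
  refine ⟨1, fun _ => Φ, fun _ => g, fun _ => hΦ, fun _ => hΦs, ?_⟩
  simp only [← pi_eq_sum_univ'] at hfg
  rw [Fin.sum_univ_one]
  exact hfg
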